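/- arXiv:2407.12763 — 4 statements merged into one kernel-verified Lean document; each statement's English description precedes it below -/
import Mathlib

section
/- Let n be a positive natural number, let V be an n×n integer matrix, and let A = V − t·Vᵀ be the associated n×n matrix over the Laurent polynomial ring ℤ[t,t⁻¹]. Let σ denote the ring automorphism of ℤ[t,t⁻¹] with σ(tᵏ) = t⁻ᵏ. Suppose v ∈ (ℤ[t,t⁻¹])ⁿ and f ∈ ℤ[t,t⁻¹] satisfy A·v = f·e₁, where e₁ is the first standard basis vector. Then the row vector (σ∘v)ᵀ·A equals (−t·σ(f))·e₁ᵀ; that is, the vector-matrix product of the entrywise σ-image of v with A is the vector whose first entry is −t·σ(f) and whose other entries are 0. -/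
open LaurentPolynomial Matrix

/-- Let `A = V - t·Vᵀ` over `ℤ[T;T⁻¹]` for an integer matrix `V`, and let
`σ` be the automorphism with `σ(tᵏ) = t⁻ᵏ` (Mathlib's `LaurentPolynomial.invert`).
If `A·v = f·e₁` then `(σ∘v)ᵀ·A = (-t·σ(f))·e₁ᵀ`. -/
theorem stmt2 (n : ℕ) (hn : 0 < n)
    (V : Matrix (Fin n) (Fin n) ℤ)
    (A : Matrix (Fin n) (Fin n) ℤ[T;T⁻¹])
    (hA : A = V.map (fun a => LaurentPolynomial.C a)
        - (T 1 : ℤ[T;T⁻¹]) • (Vᵀ.map (fun a => LaurentPolynomial.C a)))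
    (v : Fin n → ℤ[T;T⁻¹]) (f : ℤ[T;T⁻¹])
    (hv : A.mulVec v = Pi.single (⟨0, hn⟩ : Fin n) f) :
    Matrix.vecMul (fun i => LaurentPolynomial.invert (v i)) A
      = Pi.single (⟨0, hn⟩ : Fin n)
          (-(T 1 : ℤ[T;T⁻¹]) * LaurentPolynomial.invert f) := by
  have hσ (i j : Fin n) : A i j = -(T 1 : ℤ[T;T⁻¹]) * invert (A j i) := by
    have hT : (T 1 : ℤ[T;T⁻¹]) * T (-1) = 1 := by rw [← T_add, add_neg_cancel, T_zero]
    simp only [hA, Matrix.sub_apply, Matrix.smul_apply, Matrix.map_apply, Matrix.transpose_apply,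
      smul_eq_mul, map_sub, map_mul, invert_T, invert_C]
    linear_combination -(C (V i j)) * hT
  funext j
  calc Matrix.vecMul (fun i => invert (v i)) A j
      = -(T 1 : ℤ[T;T⁻¹]) * invert (A.mulVec v j) := by
        simp only [Matrix.vecMul, Matrix.mulVec, dotProduct, map_sum, map_mul, Finset.mul_sum]
        refine Finset.sum_congr rfl fun i _ => ?_
        rw [hσ i j]
        ring
    _ = _ := by
        rw [hv]
        by_cases hj : j = ⟨0, hn⟩
        · subst hj
          simp only [Pi.single_eq_same]
        · simp only [Pi.single_eq_of_ne hj, map_zero, mul_zero]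
end

section
/- Let 𝒜 = ℚ[t,t⁻¹] be the ring of Laurent polynomials over ℚ, and let n ≥ 2. If x ∈ 𝒜ⁿ is a vector whose entries generate the unit ideal of 𝒜 (i.e., the ideal generated by {x₀,…,x_{n−1}} is all of 𝒜), then there exists an n×n matrix B over 𝒜 with det B = 1 whose first column is x (i.e., B(i,0) = xᵢ for all i). -/
open LaurentPolynomial Matrix

/-- Two elements of a Bézout domain are a common multiple of the first column of a
`2 × 2` matrix of determinant `1`. -/
theorem IsBezout.exists_eq_mul_and_mul_sub_mul_eq_one {R : Type*} [CommRing R] [IsDomain R]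
    [IsBezout R] (x y : R) :
    ∃ g a b c d : R, x = g * a ∧ y = g * b ∧ a * d - c * b = 1 := by
  obtain ⟨g, hg⟩ := (IsBezout.span_pair_isPrincipal x y).principal
  have hx : x ∈ Ideal.span {x, y} := Ideal.subset_span (by simp)
  have hy : y ∈ Ideal.span {x, y} := Ideal.subset_span (by simp)
  have hgm : g ∈ Ideal.span {x, y} := by
    rw [hg]
    exact Submodule.mem_span_singleton_self g
  rw [hg] at hx hy
  obtain ⟨a, rfl⟩ := Ideal.mem_span_singleton'.1 hx
  obtain ⟨b, rfl⟩ := Ideal.mem_span_singleton'.1 hy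
  obtain ⟨u, v, huv⟩ := Ideal.mem_span_pair.1 hgm
  rcases eq_or_ne g 0 with rfl | hg0
  · exact ⟨0, 1, 0, 0, 1, by simp, by simp, by simp⟩
  · refine ⟨g, a, b, -v, u, mul_comm _ _, mul_comm _ _, mul_left_cancel₀ hg0 ?_⟩
    linear_combination huv

/-- Every vector over a Bézout domain is a multiple of the first column of a matrix of
determinant `1`. -/
theorem Matrix.exists_det_eq_one_and_eq_mul_col_zero {R : Type*} [CommRing R] [IsDomain R]
    [IsBezout R] (n : ℕ) (x : Fin (n + 1) → R) :
    ∃ (M : Matrix (Fin (n + 1)) (Fin (n + 1)) R) (g : R), M.det = 1 ∧ ∀ i, x i = g * M i 0 := by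
  induction n with
  | zero => exact ⟨1, x 0, det_one, Fin.forall_fin_one.2 (by rw [one_apply_eq, mul_one])⟩
  | succ n ih =>
    obtain ⟨M, e, hM, he⟩ := ih (fun i ↦ x i.succ)
    obtain ⟨g, a, b, c, d, ha, hb, hdet⟩ :=
      IsBezout.exists_eq_mul_and_mul_sub_mul_eq_one (x 0) e
    have minor (r : R) :
        (of fun i ↦ (Fin.cons (r * M i 0) fun j ↦ M i j.succ : Fin (n + 1) → R)).det = r := by
      have : (of fun i ↦ (Fin.cons (r * M i 0) fun j ↦ M i j.succ : Fin (n + 1) → R)) =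
          M.updateCol 0 (r • fun i ↦ M i 0) := by
        ext i j
        refine Fin.cases ?_ (fun j ↦ ?_) j <;> simp
      rw [this, det_updateCol_smul]
      have : M.updateCol 0 (fun i ↦ M i 0) = M := updateCol_eq_self M 0
      rw [this, hM, mul_one]
    refine ⟨of (Fin.cons (Fin.cons a (Fin.cons c 0)) fun i ↦
      Fin.cons (b * M i 0) (Fin.cons (d * M i 0) fun j ↦ M i j.succ)), g, ?_, fun i ↦ ?_⟩
    · have minor_one :
          (of fun i j ↦ (Fin.cons (b * M i 0) (Fin.cons (d * M i 0) fun j ↦ M i j.succ) :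
            Fin (n + 2) → R) (Fin.succAbove 1 j)).det = b := by
        refine Eq.trans ?_ (minor b)
        congr 1
        ext i j
        refine Fin.cases ?_ (fun j ↦ ?_) j
        · simp
        · have : Fin.succAbove (1 : Fin (n + 2)) j.succ = j.succ.succ :=
            Fin.succ_succAbove_succ 0 j
          simp [this]
      have hd : (of fun i j ↦ (Fin.cons (d * M i 0) (fun j ↦ M i j.succ) :
          Fin (n + 1) → R) j).det = d := minor d
      rw [det_succ_row_zero, Fin.sum_univ_succ, Fin.sum_univ_succ]
      simp [submatrix, hd, minor_one, ← sub_eq_add_neg, hdet]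
    · refine Fin.cases ?_ (fun i ↦ ?_) i
      · simpa using ha
      · simp [he, hb, mul_assoc]

/-- Over a Bézout domain, a vector with at least two entries generating the unit ideal is the
first column of a matrix of determinant `1`. -/
theorem Matrix.exists_det_eq_one_and_col_zero_eq {R : Type*} [CommRing R] [IsDomain R]
    [IsBezout R] (n : ℕ) (x : Fin (n + 2) → R) (hx : Ideal.span (Set.range x) = ⊤) :
    ∃ B : Matrix (Fin (n + 2)) (Fin (n + 2)) R, B.det = 1 ∧ ∀ i, B i 0 = x i := by
  obtain ⟨M, g, hM, hg⟩ := exists_det_eq_one_and_eq_mul_col_zero (n + 1) x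
  have hunit : IsUnit g := by
    rw [← Ideal.span_singleton_eq_top, ← top_le_iff, ← hx, Ideal.span_le]
    rintro _ ⟨i, rfl⟩
    exact Ideal.mem_span_singleton.2 ⟨_, hg i⟩
  obtain ⟨h, hh⟩ := hunit.exists_right_inv
  refine ⟨M * diagonal (Fin.cons g (Fin.cons h 1)), ?_, fun i ↦ ?_⟩
  · simp [hM, Fin.prod_univ_succ, hh]
  · simp [hg, mul_comm]

/-- A localization of a principal ideal ring is a principal ideal ring. -/
theorem IsLocalization.isPrincipalIdealRing_of_isPrincipalIdealRing {R : Type*} [CommRing R]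
    [IsPrincipalIdealRing R] (M : Submonoid R) (S : Type*) [CommRing S] [Algebra R S]
    [IsLocalization M S] : IsPrincipalIdealRing S where
  principal I := by
    obtain ⟨f, hf⟩ := IsPrincipalIdealRing.principal (I.under R)
    refine ⟨algebraMap R S f, ?_⟩
    rw [← IsLocalization.map_under M S I, hf, Ideal.submodule_span_eq, Ideal.map_span,
      Set.image_singleton, Ideal.submodule_span_eq]

instance LaurentPolynomial.isPrincipalIdealRing (K : Type*) [Field K] :
    IsPrincipalIdealRing K[T;T⁻¹] :=
  IsLocalization.isPrincipalIdealRing_of_isPrincipalIdealRing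
    (Submonoid.powers (Polynomial.X : Polynomial K)) _

/-- Over `𝒜 = ℚ[t,t⁻¹]`, any vector `x ∈ 𝒜ⁿ` whose entries generate the
unit ideal is the first column of some matrix of determinant `1`. -/
theorem stmt4 (n : ℕ) (hn : 2 ≤ n) (x : Fin n → ℚ[T;T⁻¹])
    (hx : Ideal.span (Set.range x) = ⊤) :
    ∃ B : Matrix (Fin n) (Fin n) ℚ[T;T⁻¹],
      B.det = 1 ∧ ∀ i : Fin n, B i ⟨0, by omega⟩ = x i := by
  obtain ⟨n, rfl⟩ := Nat.exists_eq_add_of_le' hn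
  exact exists_det_eq_one_and_col_zero_eq n x hx
end

section
/- Let 𝒜 = ℚ[t,t⁻¹] be the ring of Laurent polynomials over ℚ, let σ denote the ring automorphism of 𝒜 with σ(tᵏ) = t⁻ᵏ, and let n ≥ 2. Let A be an n×n matrix over 𝒜 satisfying the symmetry Aᵀ = −t·(A.map σ) (entrywise application of σ followed by transpose and scaling). Suppose there is a vector v ∈ 𝒜ⁿ and f ∈ 𝒜 such that: (i) the first entry of v is 0; (ii) the remaining entries of v generate the unit ideal of 𝒜; and (iii) A·v = f·e₁, where e₁ is the first standard basis vector. Then there exists h ∈ 𝒜 such that det A = t·f·σ(f)·h; in particular, f(t)·f(t⁻¹) divides det A up to a unit of 𝒜. -/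
open LaurentPolynomial Matrix

/-- If `d` divides `a * s` for all `s` in a set generating the unit ideal, then `d` divides `a`. -/
theorem dvd_of_forall_dvd_mul_of_span_eq_top {R : Type*} [CommRing R] {S : Set R}
    (hS : Ideal.span S = ⊤) {a d : R} (h : ∀ s ∈ S, d ∣ a * s) : d ∣ a := by
  have key : ∀ x ∈ Ideal.span S, d ∣ a * x := fun x hx => by
    induction hx using Submodule.span_induction with
    | mem x hx => exact h x hx
    | zero => simp
    | add x y _ _ hx hy => rw [mul_add]; exact dvd_add hx hy
    | smul r x _ hx => rw [smul_eq_mul, mul_left_comm]; exact hx.mul_left r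
  simpa using key 1 (by rw [hS]; trivial)

/-- If a vector whose entries generate the unit ideal satisfies `w B = g x`, then `g` divides
`det B`. -/
theorem Matrix.dvd_det_of_vecMul_eq_smul {R ι : Type*} [CommRing R] [Fintype ι] [DecidableEq ι]
    (B : Matrix ι ι R) {w x : ι → R} {g : R} {s : Set ι} (hw : Ideal.span (w '' s) = ⊤)
    (h : w ᵥ* B = g • x) : g ∣ B.det := by
  refine dvd_of_forall_dvd_mul_of_span_eq_top hw ?_
  rintro _ ⟨j, -, rfl⟩
  have h' := congrFun (congrArg (· ᵥ* B.adjugate) h) j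
  simp only [vecMul_vecMul, mul_adjugate, smul_vecMul, vecMul_smul, vecMul_one, Pi.smul_apply,
    smul_eq_mul] at h'
  exact ⟨_, h'⟩

/-- If `A v = f e_k` and `w A = g x`, where `w k = 0` and the entries of each of `v` and `w`
generate the unit ideal, then `f * g` divides `det A`. -/
theorem Matrix.mul_dvd_det_of_mulVec_eq_single {R ι : Type*} [CommRing R] [Fintype ι]
    [DecidableEq ι] (A : Matrix ι ι R) {v w x : ι → R} {f g : R} {k : ι} {s s' : Set ι}
    (hv : Ideal.span (v '' s) = ⊤) (hw : Ideal.span (w '' s') = ⊤) (hwk : w k = 0)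
    (hAv : A *ᵥ v = Pi.single k f) (hwA : w ᵥ* A = g • x) : f * g ∣ A.det := by
  refine dvd_of_forall_dvd_mul_of_span_eq_top hv ?_
  rintro _ ⟨i, -, rfl⟩
  have h := congrFun (congrArg (A.adjugate *ᵥ ·) hAv) i
  simp only [mulVec_mulVec, adjugate_mul, smul_mulVec, one_mulVec, Pi.smul_apply,
    smul_eq_mul, mulVec_single] at h
  rw [h]
  have hg : g ∣ A.adjugate i k := by
    rw [adjugate_apply]
    refine dvd_det_of_vecMul_eq_smul _ hw (x := x) ?_
    rw [← hwA]
    ext j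
    refine Finset.sum_congr rfl fun l _ => ?_
    by_cases hl : l = k
    · simp [hl, hwk]
    · simp [updateRow_ne hl]
  simpa [mul_comm] using mul_dvd_mul_left f hg

/-- Let `𝒜 = ℚ[t,t⁻¹]` and `σ` the automorphism with `σ(tᵏ) = t⁻ᵏ`
(Mathlib's `LaurentPolynomial.invert`). If an `n × n` matrix `A` over `𝒜` satisfies
`Aᵀ = -t·(A.map σ)`, and there are `v`, `f` with `v₀ = 0`, the remaining entries of `v`
generating the unit ideal, and `A·v = f·e₁`, then `det A = t·f·σ(f)·h` for some `h`. -/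
theorem stmt5 (n : ℕ) (hn : 2 ≤ n)
    (A : Matrix (Fin n) (Fin n) ℚ[T;T⁻¹])
    (hA : Aᵀ = (-(T 1 : ℚ[T;T⁻¹])) • (A.map (LaurentPolynomial.invert (R := ℚ))))
    (v : Fin n → ℚ[T;T⁻¹]) (f : ℚ[T;T⁻¹])
    (hv0 : v ⟨0, by omega⟩ = 0)
    (hvspan : Ideal.span (v '' {i : Fin n | i ≠ ⟨0, by omega⟩}) = ⊤)
    (hAv : A.mulVec v = Pi.single (⟨0, by omega⟩ : Fin n) f) :
    ∃ h : ℚ[T;T⁻¹],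
      A.det = T 1 * f * LaurentPolynomial.invert f * h := by
  have hw : Ideal.span ((fun i => invert (v i)) '' {i : Fin n | i ≠ ⟨0, by omega⟩}) = ⊤ := by
    have h := congrArg (Ideal.map (invert (R := ℚ))) hvspan
    rwa [Ideal.map_span, Ideal.map_top, Set.image_image] at h
  have hwA : (fun i => invert (v i)) ᵥ* A =
      (T 1 * invert f) • Pi.single (⟨0, by omega⟩ : Fin n) (-1 : ℚ[T;T⁻¹]) := by
    ext1 j
    have h := congrArg (invert (R := ℚ)) (congrFun hAv j)
    have hA' : ∀ i, A i j = -T 1 * invert (A j i) := fun i => congrFun (congrFun hA j) i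
    have hs : ((fun i => invert (v i)) ᵥ* A) j = -T 1 * invert ((A *ᵥ v) j) := by
      simp only [vecMul, mulVec, dotProduct, map_sum, map_mul, Finset.mul_sum]
      refine Finset.sum_congr rfl fun i _ => ?_
      rw [hA' i]
      ring
    rw [hs, h]
    by_cases hj : j = ⟨0, by omega⟩
    · subst hj
      simp
    · simp [hj]
  obtain ⟨h, hh⟩ := A.mul_dvd_det_of_mulVec_eq_single hvspan hw (by simp [hv0]) hAv hwA
  exact ⟨h, by rw [hh]; ring⟩
end

section
/- Let p₁, p₂, p₃, p₄, q be integers with pᵢ ≡ 1 (mod 4) for i = 1,2,3,4 and q ≡ 3 (mod 4). Let V be the 4×4 integer matrix whose rows are [(p₁+p₂)/2, −p₂, 0, 0], [0, (p₂+p₃)/2, −p₃, 0], [0, 0, (p₃+p₄)/2, −p₄], [0, 0, 0, (p₄−q)/2] (all diagonal entries are integers by the congruence hypotheses). Then the image of the determinant det(V − X·Vᵀ) ∈ ℤ[X] under the coefficientwise reduction map ℤ[X] → 𝔽₂[X] is an irreducible polynomial in 𝔽₂[X]. -/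
open Polynomial Matrix

theorem irreducible_quartic_zmod_two :
    Irreducible (X ^ 4 + X ^ 3 + X ^ 2 + X + 1 : (ZMod 2)[X]) := by
  have hdeg : (X ^ 4 + X ^ 3 + X ^ 2 + X + 1 : (ZMod 2)[X]).natDegree = 4 := by
    compute_degree!
  have hmonic : (X ^ 4 + X ^ 3 + X ^ 2 + X + 1 : (ZMod 2)[X]).Monic := by monicity!
  have hne : (X ^ 4 + X ^ 3 + X ^ 2 + X + 1 : (ZMod 2)[X]) ≠ 1 := by
    intro h
    simp [h] at hdeg
  have hroot : ∀ a : ZMod 2,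
      (X ^ 4 + X ^ 3 + X ^ 2 + X + 1 : (ZMod 2)[X]).eval a ≠ 0 := by
    intro a
    simp only [eval_add, eval_pow, eval_X, eval_one]
    revert a
    decide
  rw [hmonic.irreducible_iff_lt_natDegree_lt hne]
  intro f hf hfdeg hdvd
  rw [hdeg, Finset.mem_Ioc] at hfdeg
  have hfroot (a : ZMod 2) : f.eval a ≠ 0 := fun h =>
    hroot a (zero_dvd_iff.mp (h ▸ eval_dvd hdvd))
  have hsum : f = C (f.coeff 2) * X ^ 2 + C (f.coeff 1) * X + C (f.coeff 0) :=
    eq_quadratic_of_degree_le_two ((natDegree_le_iff_degree_le (n := 2)).mp hfdeg.2)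
  have hlead : f.coeff f.natDegree = 1 := hf
  have h0 := hfroot 0
  have h1 := hfroot 1
  rw [hsum] at h0 h1
  simp only [eval_add, eval_mul, eval_C, eval_pow, eval_X] at h0 h1
  have hcoeff : ∀ a b c : ZMod 2, a * 0 ^ 2 + b * 0 + c ≠ 0 → a * 1 ^ 2 + b * 1 + c ≠ 0 →
      c = 1 ∧ a = b := by decide
  obtain ⟨hc, hab⟩ := hcoeff _ _ _ h0 h1
  obtain hd | hd : f.natDegree = 1 ∨ f.natDegree = 2 := by omega
  · have h2 : f.coeff 2 = 0 := coeff_eq_zero_of_natDegree_lt (by omega)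
    rw [hd, ← hab, h2] at hlead
    exact zero_ne_one hlead
  · rw [hd] at hlead
    have hf' : f = X ^ 2 + X + 1 := by
      rw [hsum, ← hab, hlead, hc]
      simp
    have hrem : f ∣ X + 1 := by
      have hsplit : (X ^ 4 + X ^ 3 + X ^ 2 + X + 1 : (ZMod 2)[X]) = f * X ^ 2 + (X + 1) := by
        rw [hf']
        ring
      rwa [hsplit, dvd_add_right (dvd_mul_right f _)] at hdvd
    have hX : (X + 1 : (ZMod 2)[X]).natDegree = 1 := by compute_degree!
    have hle := natDegree_le_of_dvd hrem (by intro h; simp [h] at hX)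
    omega

/-- For integers `pᵢ ≡ 1 (mod 4)` and `q ≡ 3 (mod 4)`, the mod-2 reduction
of the determinant of `V - X·Vᵀ`, where `V` is the Seifert matrix of the pretzel knot
`P(p₁,p₂,p₃,p₄,-q)`, is irreducible in `𝔽₂[X]`. -/
theorem stmt9 (p₁ p₂ p₃ p₄ q : ℤ)
    (h₁ : p₁ ≡ 1 [ZMOD 4]) (h₂ : p₂ ≡ 1 [ZMOD 4]) (h₃ : p₃ ≡ 1 [ZMOD 4])
    (h₄ : p₄ ≡ 1 [ZMOD 4]) (hq : q ≡ 3 [ZMOD 4])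
    (V : Matrix (Fin 4) (Fin 4) ℤ)
    (hV : V = !![(p₁ + p₂) / 2, -p₂, 0, 0;
                 0, (p₂ + p₃) / 2, -p₃, 0;
                 0, 0, (p₃ + p₄) / 2, -p₄;
                 0, 0, 0, (p₄ - q) / 2]) :
    Irreducible
      ((Matrix.det (V.map (fun a => (Polynomial.C a : ℤ[X]))
          - (X : ℤ[X]) • (Vᵀ.map (fun a => (Polynomial.C a : ℤ[X]))))).map
          (Int.castRingHom (ZMod 2))) := by
  have hodd {a : ℤ} (ha : a % 2 = 1) : (a : ZMod 2) = 1 := by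
    exact_mod_cast (ZMod.intCast_eq_intCast_iff a 1 2).mpr ha
  simp only [Int.ModEq] at h₁ h₂ h₃ h₄ hq
  have e₁ : (((p₁ + p₂) / 2 : ℤ) : ZMod 2) = 1 := hodd (by omega)
  have e₂ : (((p₂ + p₃) / 2 : ℤ) : ZMod 2) = 1 := hodd (by omega)
  have e₃ : (((p₃ + p₄) / 2 : ℤ) : ZMod 2) = 1 := hodd (by omega)
  have e₄ : (((p₄ - q) / 2 : ℤ) : ZMod 2) = 1 := hodd (by omega)
  have o₂ : ((p₂ : ℤ) : ZMod 2) = 1 := hodd (by omega)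
  have o₃ : ((p₃ : ℤ) : ZMod 2) = 1 := hodd (by omega)
  have o₄ : ((p₄ : ℤ) : ZMod 2) = 1 := hodd (by omega)
  convert irreducible_quartic_zmod_two using 1
  rw [← coe_mapRingHom, RingHom.map_det]
  have hM : (mapRingHom (Int.castRingHom (ZMod 2))).mapMatrix
      (V.map (fun a => (C a : ℤ[X])) - (X : ℤ[X]) • (Vᵀ.map (fun a => (C a : ℤ[X])))) =
      !![1 - X, -1, 0, 0; X, 1 - X, -1, 0; 0, X, 1 - X, -1; 0, 0, X, 1 - X] := by
    subst hV
    ext1 i j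
    fin_cases i <;> fin_cases j <;>
      simp [-eq_intCast, -map_intCast, e₁, e₂, e₃, e₄, o₂, o₃, o₄]
  rw [hM]
  have h2 : (2 : (ZMod 2)[X]) = 0 := CharTwo.two_eq_zero
  simp [det_succ_row_zero, Fin.sum_univ_succ, Fin.succAbove]
  linear_combination (-X - X ^ 3) * h2
end
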